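/- arXiv:math/0311085 — 4 statements merged into one kernel-verified Lean document; each statement's English description precedes it below -/
import Mathlib

section
/- Let F be a multihomogeneous polynomial of multidegree (d₁,…,d_r) over ℂ. Then there exists a finite family P₁,…,P_N of homogeneous polynomials in the (k+1)^r Segre variables Z_{j₁,…,j_r}, each of degree at most max{r, d₁+⋯+d_r}, such that for every nonzero vector z ∈ ℂ^{(k+1)^r} the following are equivalent: (a) P_s(z) = 0 for all s = 1,…,N; (b) there exist nonzero vectors x₁,…,x_r ∈ ℂ^{k+1} with F(x₁,…,x_r) = 0 such that z is the associated Segre point, i.e. z_{j₁,…,j_r} = ∏_{t=1}^r x_t(j_t) for all indices. (This is the set-theoretic content of the paper's Lemma on degree bounds for Segre images of multihomogeneous hypersurfaces.) -/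
open MvPolynomial

section Segre

variable {R κ τ : Type*} [CommRing R]

/-- The value of a multihomogeneous polynomial after rescaling each group of variables. -/
theorem eval_smul_of_multihomogeneous [Fintype κ] [Fintype τ]
    {d : τ → ℕ} {F : MvPolynomial (τ × κ) R}
    (hF : ∀ c ∈ F.support, ∀ t : τ, (∑ j : κ, c (t, j)) = d t) (a : τ → R) (x : τ → κ → R) :
    eval (fun p : τ × κ => a p.1 * x p.1 p.2) F =
      (∏ t, a t ^ d t) * eval (fun p : τ × κ => x p.1 p.2) F := by
  rw [eval_eq', eval_eq', Finset.mul_sum]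
  refine Finset.sum_congr rfl fun c hc => ?_
  have h : ∏ p : τ × κ, a p.1 ^ c p = ∏ t, a t ^ d t := by
    rw [Fintype.prod_prod_type]
    exact Finset.prod_congr rfl fun t _ => by
      simp only [Finset.prod_pow_eq_pow_sum, hF c hc t]
  simp only [mul_pow, Finset.prod_mul_distrib, h]
  ring

theorem isHomogeneous_of_multihomogeneous [Fintype κ] [Fintype τ]
    {d : τ → ℕ} {F : MvPolynomial (τ × κ) R}
    (hF : ∀ c ∈ F.support, ∀ t : τ, (∑ j : κ, c (t, j)) = d t) :
    F.IsHomogeneous (∑ t, d t) := by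
  intro c hc
  rw [Finsupp.weight_apply, Finsupp.sum_fintype _ _ (by simp), Fintype.sum_prod_type]
  exact Finset.sum_congr rfl fun t _ => by simpa using hF c (mem_support_iff.mpr hc) t

variable [DecidableEq τ]

/-- The substitution of the `i`-th slice of the Segre variables into `F`. -/
noncomputable def segreSubst (F : MvPolynomial (τ × κ) R) (i : τ → κ) : MvPolynomial (τ → κ) R :=
  rename (fun p => Function.update i p.1 p.2) F

/-- The quadric exchanging the `t`-th entries of two multi-indices. -/
noncomputable def segreQuadric (R : Type*) [CommRing R] (i j : τ → κ) (t : τ) :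
    MvPolynomial (τ → κ) R :=
  X i * X j - X (Function.update i t (j t)) * X (Function.update j t (i t))

theorem segreQuadric_isHomogeneous (i j : τ → κ) (t : τ) :
    (segreQuadric R i j t).IsHomogeneous 2 :=
  ((isHomogeneous_X R _).mul (isHomogeneous_X R _)).sub
    ((isHomogeneous_X R _).mul (isHomogeneous_X R _))

theorem segreQuadric_eq_zero [Subsingleton τ] (i j : τ → κ) (t : τ) :
    segreQuadric R i j t = 0 := by
  have h (u v : τ → κ) : Function.update u t (v t) = v := by
    funext s
    obtain rfl := Subsingleton.elim s t
    simp
  rw [segreQuadric, h, h, mul_comm, sub_self]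

theorem eval_segreQuadric_segre [Fintype τ] (x : τ → κ → R) (i j : τ → κ) (t : τ) :
    eval (fun j => ∏ t, x t (j t)) (segreQuadric R i j t) = 0 := by
  simp only [segreQuadric, map_sub, map_mul, eval_X, ← Finset.prod_mul_distrib, sub_eq_zero]
  refine Finset.prod_congr rfl fun s _ => ?_
  rcases eq_or_ne s t with rfl | hs
  · simp [mul_comm]
  · simp [hs]

theorem eval_segreSubst_segre [Fintype κ] [Fintype τ] {d : τ → ℕ} {F : MvPolynomial (τ × κ) R}
    (hF : ∀ c ∈ F.support, ∀ t : τ, (∑ j : κ, c (t, j)) = d t) (x : τ → κ → R) (i : τ → κ) :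
    eval (fun j => ∏ t, x t (j t)) (segreSubst F i) =
      (∏ t, (∏ s ∈ Finset.univ.erase t, x s (i s)) ^ d t) *
        eval (fun p : τ × κ => x p.1 p.2) F := by
  rw [← eval_smul_of_multihomogeneous hF, segreSubst, eval_rename]
  congr 2
  funext p
  rw [Function.comp_apply, ← Finset.mul_prod_erase _ _ (Finset.mem_univ p.1), mul_comm]
  congr 1
  · exact Finset.prod_congr rfl fun s hs => by simp [Finset.ne_of_mem_erase hs]
  · simp

theorem mul_pow_eq_of_segreQuadric [Fintype τ] {z : (τ → κ) → R}
    (hz : ∀ i j t, eval z (segreQuadric R i j t) = 0) (i j : τ → κ) :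
    z j * z i ^ Fintype.card τ = z i * ∏ t, z (Function.update i t (j t)) := by
  have key (S : Finset τ) :
      z (S.piecewise j i) * z i ^ S.card = z i * ∏ t ∈ S, z (Function.update i t (j t)) := by
    induction S using Finset.induction_on with
    | empty => simp
    | insert t S ht ih =>
      have h := hz ((insert t S).piecewise j i) i t
      have h₁ : Function.update ((insert t S).piecewise j i) t (i t) = S.piecewise j i := by
        rw [Finset.piecewise_insert, Function.update_idem]
        exact Function.update_eq_self_iff.mpr (by simp [ht])
      simp only [segreQuadric, map_sub, map_mul, eval_X, h₁, sub_eq_zero,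
        Finset.piecewise_insert_self] at h
      rw [Finset.card_insert_of_notMem ht, Finset.prod_insert ht, pow_succ']
      linear_combination z i ^ S.card * h + z (Function.update i t (j t)) * ih
  simpa using key Finset.univ

theorem exists_segre_of_segreQuadric {K : Type*} [Field K] [IsAlgClosed K] [Fintype τ] [Nonempty τ]
    {z : (τ → κ) → K} (hz : ∀ i j t, eval z (segreQuadric K i j t) = 0) (h0 : z ≠ 0) :
    ∃ x : τ → κ → K, z = fun j => ∏ t, x t (j t) := by
  obtain ⟨i, hi⟩ := Function.ne_iff.mp h0
  rw [Pi.zero_apply] at hi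
  obtain ⟨c, hc⟩ := IsAlgClosed.exists_pow_nat_eq (z i / z i ^ Fintype.card τ)
    (Fintype.card_pos (α := τ))
  refine ⟨fun t a => c * z (Function.update i t a), funext fun j => ?_⟩
  have h := mul_pow_eq_of_segreQuadric hz i j
  rw [Finset.prod_mul_distrib, Finset.prod_const, Finset.card_univ, hc, div_mul_eq_mul_div, ← h,
    mul_div_cancel_right₀ _ (pow_ne_zero _ hi)]

end Segre

/-- Set-theoretic degree bound for the Segre image of a
multihomogeneous hypersurface. -/
theorem segre_image_defined_by_bounded_degree_equations
    (k r : ℕ) (hk : 1 ≤ k) (hr : 1 ≤ r) (d : Fin r → ℕ)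
    (F : MvPolynomial (Fin r × Fin (k + 1)) ℂ)
    (hF : ∀ c ∈ F.support, ∀ t : Fin r, (∑ j : Fin (k + 1), c (t, j)) = d t) :
    ∃ (N : ℕ) (P : Fin N → MvPolynomial (Fin r → Fin (k + 1)) ℂ),
      (∀ s : Fin N, ∃ e : ℕ, e ≤ max r (∑ t, d t) ∧ (P s).IsHomogeneous e) ∧
      ∀ z : (Fin r → Fin (k + 1)) → ℂ, z ≠ 0 →
        ((∀ s : Fin N, MvPolynomial.eval z (P s) = 0) ↔
          ∃ x : Fin r → Fin (k + 1) → ℂ,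
            (∀ t : Fin r, x t ≠ 0) ∧
            MvPolynomial.eval (fun p : Fin r × Fin (k + 1) => x p.1 p.2) F = 0 ∧
            ∀ j : Fin r → Fin (k + 1), z j = ∏ t : Fin r, x t (j t)) := by
  have : Nonempty (Fin r) := ⟨⟨0, hr⟩⟩
  let I := Fin r → Fin (k + 1)
  let Q : I ⊕ (I × I × Fin r) → MvPolynomial I ℂ :=
    Sum.elim (segreSubst F) fun q => segreQuadric ℂ q.1 q.2.1 q.2.2
  let e := Fintype.equivFin (I ⊕ (I × I × Fin r))
  have hQ : ∀ q, ∃ n ≤ max r (∑ t, d t), (Q q).IsHomogeneous n := by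
    rintro (i | ⟨i, j, t⟩)
    · exact ⟨_, le_max_right _ _, (isHomogeneous_of_multihomogeneous hF).rename_isHomogeneous⟩
    · rcases hr.eq_or_lt with rfl | hr2
      · refine ⟨0, Nat.zero_le _, ?_⟩
        simp only [Q, Sum.elim_inr, segreQuadric_eq_zero]
        exact isHomogeneous_zero _ _ _
      · exact ⟨2, le_max_of_le_left hr2, segreQuadric_isHomogeneous i j t⟩
  refine ⟨_, fun s => Q (e.symm s), fun s => hQ _, fun z hz => ⟨fun h => ?_, ?_⟩⟩
  · replace h : ∀ q, eval z (Q q) = 0 := fun q => by simpa using h (e q)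
    obtain ⟨x, rfl⟩ := exists_segre_of_segreQuadric (fun i j t => h (.inr (i, j, t))) hz
    obtain ⟨i, hi⟩ := Function.ne_iff.mp hz
    have hx : ∀ t, x t (i t) ≠ 0 := fun t => Finset.prod_ne_zero_iff.mp hi t (Finset.mem_univ t)
    refine ⟨x, fun t ht => hx t (by simp [ht]), ?_, fun _ => rfl⟩
    have hF0 := h (.inl i)
    simp only [Q, Sum.elim_inl, eval_segreSubst_segre hF] at hF0
    exact (mul_eq_zero.mp hF0).resolve_left <| Finset.prod_ne_zero_iff.mpr fun t _ =>
      pow_ne_zero _ <| Finset.prod_ne_zero_iff.mpr fun s _ => hx s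
  · rintro ⟨x, -, hFx, hx⟩ s
    obtain rfl : z = fun j => ∏ t, x t (j t) := funext hx
    show eval _ (Q (e.symm s)) = 0
    rcases e.symm s with i | ⟨i, j, t⟩
    · simp only [Q, Sum.elim_inl, eval_segreSubst_segre hF, hFx, mul_zero]
    · exact eval_segreQuadric_segre x i j t
end

section
/- Let F be a multihomogeneous polynomial of multidegree (d₁,…,d_r) over ℂ, let x₁,…,x_r ∈ ℂ^{k+1}, and let z be the associated Segre point. Then for every multi-index (i₁,…,i_r) ∈ {0,…,k}^r, the evaluation of the substituted polynomial F_{i₁,…,i_r} at z satisfies F_{i₁,…,i_r}(z) = (∏_{t=1}^r c_t^{d_t}) · F(x₁,…,x_r), where c_t := ∏_{t' ≠ t} x_{t'}(i_{t'}). In particular, if F(x₁,…,x_r) = 0 then all the substituted polynomials vanish at z. -/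
open MvPolynomial

/-- evaluation of the substituted polynomial `F_{i₁,…,i_r}` at the
Segre point associated to `x₁,…,x_r`. -/
theorem substituted_polynomial_eval_at_segre_point
    (k r : ℕ) (hk : 1 ≤ k) (hr : 1 ≤ r) (d : Fin r → ℕ)
    (F : MvPolynomial (Fin r × Fin (k + 1)) ℂ)
    (hF : ∀ c ∈ F.support, ∀ t : Fin r, (∑ j : Fin (k + 1), c (t, j)) = d t)
    (x : Fin r → Fin (k + 1) → ℂ)
    (z : (Fin r → Fin (k + 1)) → ℂ)
    (hz : ∀ j : Fin r → Fin (k + 1), z j = ∏ t : Fin r, x t (j t))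
    (i : Fin r → Fin (k + 1)) :
    MvPolynomial.eval z
        (MvPolynomial.rename
          (fun p : Fin r × Fin (k + 1) => Function.update i p.1 p.2) F)
      = (∏ t : Fin r, (∏ t' ∈ Finset.univ.erase t, x t' (i t')) ^ d t) *
          MvPolynomial.eval (fun p : Fin r × Fin (k + 1) => x p.1 p.2) F := by
  have hz_update (p : Fin r × Fin (k + 1)) : z (Function.update i p.1 p.2) =
      (∏ t' ∈ Finset.univ.erase p.1, x t' (i t')) * x p.1 p.2 := by
    rw [hz, ← Finset.prod_erase_mul _ _ (Finset.mem_univ p.1), Function.update_self]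
    congr 1
    refine Finset.prod_congr rfl fun t' ht' => ?_
    rw [Function.update_of_ne (Finset.ne_of_mem_erase ht')]
  rw [eval_rename, eval_eq', eval_eq', Finset.mul_sum]
  refine Finset.sum_congr rfl fun c hc => ?_
  simp only [Function.comp_apply, hz_update, mul_pow, Finset.prod_mul_distrib]
  rw [Fintype.prod_prod_type (fun p : Fin r × Fin (k + 1) =>
    (∏ t' ∈ Finset.univ.erase p.1, x t' (i t')) ^ c p)]
  simp only [Finset.prod_pow_eq_pow_sum, hF c hc]
  ring
end

section
/- In the polynomial ring R with variables Z₀,…,Z_m and (A_μ)_{|μ|=l}, let F = Σ_{|μ|=l} A_μ Z^μ and, for fixed complex constants (b_μ)_{|μ|=l}, let G = Σ_{|μ|=l} b_μ A_μ. For 1 ≤ i ≤ m define the derivation V_i = (Σ_{|μ|=l} μ_i b_μ A_μ)·(Z₀·∂/∂Z₀ − Σ_{|μ|=l} μ₀ A_μ·∂/∂A_μ) − (Σ_{|μ|=l} μ₀ b_μ A_μ)·(Z_i·∂/∂Z_i − Σ_{|μ|=l} μ_i A_μ·∂/∂A_μ). Then V_i(F) = 0 and V_i(G) = 0. (This is the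 cleared-denominator form of the first family of meromorphic vector fields of low pole order constructed in the proof of the generalization of Clemens' theorem; the identity expresses their tangency to the universal hypersurface 𝔛 = {Σ A_μ Z^μ = 0} ∩ {Σ b_μ A_μ = 0}.) -/
open MvPolynomial

/-- A derivation that annihilates every factor of a finite product annihilates the product. -/
theorem Derivation.map_prod_eq_zero {R A M ι : Type*} [CommSemiring R] [CommSemiring A]
    [AddCommMonoid M] [Algebra R A] [Module A M] [Module R M] [IsCancelAdd M]
    (D : Derivation R A M) (s : Finset ι)
    (f : ι → A) (h : ∀ i ∈ s, D (f i) = 0) : D (∏ i ∈ s, f i) = 0 :=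
  Finset.prod_induction f (fun x => D x = 0) (fun x y hx hy => by simp [hx, hy])
    (by simp) h

namespace MvPolynomial

variable {R ι κ : Type*} [CommRing R]

theorem pderiv_inr_prod_X_inl_pow [Fintype ι] (ν : κ) (μ : ι → ℕ) :
    pderiv (R := R) (Sum.inr ν) (∏ i, X (Sum.inl i : ι ⊕ κ) ^ μ i) = 0 :=
  Derivation.map_prod_eq_zero _ _ _ fun i _ => by
    rw [Derivation.leibniz_pow, pderiv_X_of_ne Sum.inl_ne_inr, smul_zero, smul_zero]

theorem X_mul_pderiv_inl_prod_X_inl_pow [Fintype ι] (j : ι) (μ : ι → ℕ) :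
    X (Sum.inl j) * pderiv (R := R) (Sum.inl j) (∏ i, X (Sum.inl i : ι ⊕ κ) ^ μ i) =
      (μ j : MvPolynomial (ι ⊕ κ) R) * ∏ i, X (Sum.inl i) ^ μ i := by
  classical
  rw [← Finset.mul_prod_erase Finset.univ _ (Finset.mem_univ j), Derivation.leibniz,
    Derivation.map_prod_eq_zero (pderiv _) (Finset.univ.erase j), Derivation.leibniz_pow,
    pderiv_X_self]
  · rcases hn : μ j with _ | n
    · simp
    · simp only [smul_eq_mul, nsmul_eq_mul, Nat.add_sub_cancel]
      ring
  · intro i hi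
    rw [Derivation.leibniz_pow,
      pderiv_X_of_ne (Sum.inl_injective.ne (Finset.ne_of_mem_erase hi)), smul_zero, smul_zero]

theorem pderiv_inr_sum_X_inr_mul (T : Finset κ)
    (c : κ → MvPolynomial (ι ⊕ κ) R)
    (ν : κ) (hν : ν ∈ T) (hc : ∀ μ ∈ T, pderiv (Sum.inr ν) (c μ) = 0) :
    pderiv (Sum.inr ν) (∑ μ ∈ T, X (Sum.inr μ) * c μ) = c ν := by
  rw [map_sum, Finset.sum_eq_single_of_mem ν hν]
  · simp [hc ν hν]
  · intro μ hμ hne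
    simp [hc μ hμ, pderiv_X_of_ne (Sum.inr_injective.ne hne)]

end MvPolynomial

/-- the first family of (cleared-denominator) meromorphic vector
fields `V_i = (Σ μ_i b_μ A_μ)·D₀ − (Σ μ₀ b_μ A_μ)·D_i` annihilates both
`F = Σ_{|μ|=l} A_μ Z^μ` and `G = Σ_{|μ|=l} b_μ A_μ`. -/
theorem first_vector_fields_tangent_to_universal_hypersurface
    (m l : ℕ) (hm : 1 ≤ m) (hl : 1 ≤ l)
    (b : (Fin (m + 1) → ℕ) → ℂ)
    (F G : MvPolynomial (Fin (m + 1) ⊕ (Fin (m + 1) → ℕ)) ℂ)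
    (hF : F = ∑ μ ∈ Finset.Nat.antidiagonalTuple (m + 1) l,
        X (Sum.inr μ) * ∏ i : Fin (m + 1), X (Sum.inl i) ^ μ i)
    (hG : G = ∑ μ ∈ Finset.Nat.antidiagonalTuple (m + 1) l,
        C (b μ) * X (Sum.inr μ))
    (S : Fin (m + 1) → MvPolynomial (Fin (m + 1) ⊕ (Fin (m + 1) → ℕ)) ℂ)
    (hS : ∀ j : Fin (m + 1), S j = ∑ μ ∈ Finset.Nat.antidiagonalTuple (m + 1) l,
        (μ j : MvPolynomial (Fin (m + 1) ⊕ (Fin (m + 1) → ℕ)) ℂ) *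
          C (b μ) * X (Sum.inr μ))
    (D : Fin (m + 1) → MvPolynomial (Fin (m + 1) ⊕ (Fin (m + 1) → ℕ)) ℂ →
        MvPolynomial (Fin (m + 1) ⊕ (Fin (m + 1) → ℕ)) ℂ)
    (hD : ∀ (j : Fin (m + 1)) (H : MvPolynomial (Fin (m + 1) ⊕ (Fin (m + 1) → ℕ)) ℂ),
        D j H = X (Sum.inl j) * pderiv (Sum.inl j) H
          - ∑ μ ∈ Finset.Nat.antidiagonalTuple (m + 1) l,
              (μ j : MvPolynomial (Fin (m + 1) ⊕ (Fin (m + 1) → ℕ)) ℂ) *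
                X (Sum.inr μ) * pderiv (Sum.inr μ) H)
    (i : Fin (m + 1)) (hi : i ≠ 0) :
    S i * D 0 F - S 0 * D i F = 0 ∧ S i * D 0 G - S 0 * D i G = 0 := by
  have hDF (j) : D j F = 0 := by
    rw [hD, hF, sub_eq_zero, map_sum, Finset.mul_sum]
    refine Finset.sum_congr rfl fun μ hμ => ?_
    rw [pderiv_inr_sum_X_inr_mul _ _ μ hμ fun ν _ => pderiv_inr_prod_X_inl_pow μ ν,
      Derivation.leibniz, pderiv_X_of_ne Sum.inr_ne_inl, smul_zero, add_zero, smul_eq_mul,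
      mul_left_comm, X_mul_pderiv_inl_prod_X_inl_pow]
    ring
  have hDG (j) : D j G = -S j := by
    simp only [mul_comm (C _) (X _)] at hG
    have hZ : pderiv (Sum.inl j) G = 0 := by
      rw [hG, map_sum]
      exact Finset.sum_eq_zero fun μ _ => by simp
    rw [hD, hZ, mul_zero, zero_sub, hS, hG]
    refine congrArg _ (Finset.sum_congr rfl fun μ hμ => ?_)
    rw [pderiv_inr_sum_X_inr_mul _ _ μ hμ fun ν _ => pderiv_C]
    ring
  rw [hDF, hDF, hDG, hDG]
  constructor <;> ring
end

section
/- Let M ≥ 1 and δ₀ ≥ 1 be integers and let V be a vector space over ℂ. Let a : {1,…,δ₀M} × {1,…,M} → ℂ satisfy the nondegeneracy condition: for all pairwise distinct β⁽¹⁾,…,β⁽ᴹ⁾ ∈ {1,…,δ₀M}, the M×M matrix (a(β⁽ᵉ⁾, α))_{e,α=1,…,M} has nonzero determinant. Let J be a set, let J̃ be a finite set with |J̃| = δ₀, and let g : J → ({1,…,M} → V) and g̃ : J̃ → ({1,…,M} → V). Suppose that for every j ∈ J and every β ∈ {1,…,δ₀M} there exists j̃(j,β) ∈ J̃ such that Σ_{α=1}^{M}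 a(β,α)·(g(j)(α) − g̃(j̃(j,β))(α)) = 0 in V. Then for every j ∈ J there exists j̃ ∈ J̃ with g(j)(α) = g̃(j̃)(α) for all α ∈ {1,…,M}. (This pigeonhole-plus-nondegeneracy argument is the core of the injectivity lemma for the projections π_ν on Chow varieties: after projecting, matching germs of the two curves must coincide identically.) -/
/-- A square matrix with nonzero determinant acts injectively on families of vectors. -/
theorem Matrix.eq_zero_of_sum_smul_eq_zero {K V ι : Type*} [Field K] [AddCommGroup V] [Module K V]
    [Fintype ι] [DecidableEq ι] {A : Matrix ι ι K} (hA : A.det ≠ 0) {v : ι → V}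
    (hv : ∀ e, ∑ α, A e α • v α = 0) (γ : ι) : v γ = 0 := by
  have hinv : A⁻¹ * A = 1 := A.nonsing_inv_mul hA.isUnit
  calc
    v γ = ∑ α, (A⁻¹ * A) γ α • v α := by simp [hinv, Matrix.one_apply]
    _ = ∑ e, A⁻¹ γ e • ∑ α, A e α • v α := by
      simp only [Matrix.mul_apply, Finset.sum_smul, Finset.smul_sum, mul_smul]
      exact Finset.sum_comm
    _ = 0 := by simp [hv]

/-- the pigeonhole-plus-nondegeneracy core of the injectivity
lemma for the projections `π_ν`. -/
theorem pigeonhole_nondegeneracy_matching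
    (M δ₀ : ℕ) (hM : 1 ≤ M) (hδ₀ : 1 ≤ δ₀)
    (V : Type*) [AddCommGroup V] [Module ℂ V]
    (a : Fin (δ₀ * M) → Fin M → ℂ)
    (ha : ∀ β : Fin M → Fin (δ₀ * M), Function.Injective β →
        (Matrix.of fun (e : Fin M) (α : Fin M) => a (β e) α).det ≠ 0)
    (J J' : Type*) [Fintype J'] (hcard : Fintype.card J' = δ₀)
    (g : J → Fin M → V) (g' : J' → Fin M → V)
    (h : ∀ (j : J) (β : Fin (δ₀ * M)), ∃ j'' : J',
        (∑ α : Fin M, a β α • (g j α - g' j'' α)) = 0) :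
    ∀ j : J, ∃ j'' : J', ∀ α : Fin M, g j α = g' j'' α := by
  intro j
  choose f hf using h j
  have : Nonempty J' := Fintype.card_pos_iff.mp (by omega)
  classical
  obtain ⟨j'', hj''⟩ := Fintype.exists_le_card_fiber_of_mul_le_card f (n := M)
    (by rw [hcard, Fintype.card_fin])
  obtain ⟨s, hs, hsM⟩ := Finset.exists_subset_card_eq hj''
  let β := s.orderEmbOfFin hsM
  refine ⟨j'', fun α => sub_eq_zero.mp ?_⟩
  refine Matrix.eq_zero_of_sum_smul_eq_zero (v := fun α => g j α - g' j'' α)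
    (ha β β.injective) (fun e => ?_) α
  have hfe : f (β e) = j'' := (Finset.mem_filter.mp (hs (s.orderEmbOfFin_mem hsM e))).2
  simpa only [hfe, Matrix.of_apply] using hf (β e)
end
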